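/- Let n ≥ 1 and let ω = (p₀, p₁, …, p_n) be positive integers with gcd(p₀, p₁, …, p_n) = 1. Suppose d = gcd(p₁, …, p_n) and set η = (p₀, p₁/d, …, p_n/d). Define ℙⁿ_ω as the quotient of ℂ^{n+1} ∖ {0} by the equivalence relation (x₀,…,x_n) ∼ (t^{p₀}x₀, …, t^{p_n}x_n) for t ∈ ℂ ∖ {0}, with the quotient topology, and define ℙⁿ_η analogously for the weights η. Then the map (x₀, x₁, …, x_n) ↦ (x₀^d, x₁, …, x_n) descends to a well-defined homeomorphism ℙⁿ_ω → ℙⁿ_η, sending [x₀ : x₁ : ⋯ : x_n]_ω to [x₀^d : x₁ : ⋯ : x_n]_η. -/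

import Mathlib

/-- The `ω`-weighted equivalence on `ℂ^{n+1} ∖ {0}`: `(x_i) ∼ (t^{ω_i}·x_i)` for
`t ∈ ℂ*`. -/
def wpRel {n : ℕ} (ω : Fin (n + 1) → ℕ) (v w : {v : Fin (n + 1) → ℂ // v ≠ 0}) : Prop :=
  ∃ t : ℂ, t ≠ 0 ∧ ∀ i, (w : Fin (n + 1) → ℂ) i = t ^ ω i * (v : Fin (n + 1) → ℂ) i

/-- The weighted projective space `ℙⁿ_ω`, with the quotient topology. -/
def WProjSpace {n : ℕ} (ω : Fin (n + 1) → ℕ) : Type :=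
  Quot (wpRel ω)

noncomputable instance {n : ℕ} (ω : Fin (n + 1) → ℕ) : TopologicalSpace (WProjSpace ω) :=
  inferInstanceAs (TopologicalSpace (Quot _))

lemma pow_fst_ne_zero {n : ℕ} {d : ℕ} (hd : 0 < d) {v : Fin (n + 1) → ℂ} (hv : v ≠ 0) :
    (fun i => if i = 0 then v 0 ^ d else v i) ≠ (0 : Fin (n + 1) → ℂ) := by
  intro h
  apply hv
  funext i
  have hi := congrFun h i
  by_cases h0 : i = 0
  · subst h0
    simp only [if_pos rfl, Pi.zero_apply] at hi ⊢
    exact (pow_eq_zero_iff hd.ne').mp hi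
  · simpa [h0] using hi

lemma gcd_tail_pos (n : ℕ) (hn : 1 ≤ n) (ω : Fin (n + 1) → ℕ) (hpos : ∀ i, 0 < ω i) :
    0 < (Finset.univ.erase (0 : Fin (n + 1))).gcd ω := by
  rcases Nat.eq_zero_or_pos ((Finset.univ.erase (0 : Fin (n + 1))).gcd ω) with h | h
  · exfalso
    rw [Finset.gcd_eq_zero_iff] at h
    have h1 : (⟨1, by omega⟩ : Fin (n + 1)) ∈ Finset.univ.erase (0 : Fin (n + 1)) := by
      simp [Finset.mem_erase, Fin.ext_iff]
    exact (hpos _).ne' (h _ h1)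
  · exact h

lemma wpRel_equivalence {n : ℕ} (ω : Fin (n + 1) → ℕ) : Equivalence (wpRel ω) where
  refl v := ⟨1, one_ne_zero, fun i => by simp⟩
  symm := by
    rintro v w ⟨t, ht, h⟩
    refine ⟨t⁻¹, inv_ne_zero ht, fun i => ?_⟩
    rw [h, inv_pow, inv_mul_cancel_left₀ (pow_ne_zero _ ht)]
  trans := by
    rintro u v w ⟨s, hs, h⟩ ⟨t, ht, h'⟩
    refine ⟨t * s, mul_ne_zero ht hs, fun i => ?_⟩
    rw [h', h, mul_pow, mul_assoc]

/-- The map `(x₀, x₁, …, x_n) ↦ (x₀ ^ d, x₁, …, x_n)` on `ℂ^{n+1} ∖ {0}`. -/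
def powFst {n d : ℕ} (hd : 0 < d) (v : {v : Fin (n + 1) → ℂ // v ≠ 0}) :
    {v : Fin (n + 1) → ℂ // v ≠ 0} :=
  ⟨fun i => if i = 0 then v.1 0 ^ d else v.1 i, pow_fst_ne_zero hd v.2⟩

lemma powFst_apply_zero {n d : ℕ} (hd : 0 < d) (v : {v : Fin (n + 1) → ℂ // v ≠ 0}) :
    (powFst hd v).1 0 = v.1 0 ^ d := rfl

lemma powFst_apply_of_ne {n d : ℕ} (hd : 0 < d) (v : {v : Fin (n + 1) → ℂ // v ≠ 0})
    {i : Fin (n + 1)} (hi : i ≠ 0) : (powFst hd v).1 i = v.1 i :=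
  if_neg hi

lemma isOpenQuotientMap_powFst {n d : ℕ} (hd : 0 < d) :
    IsOpenQuotientMap (powFst (n := n) hd) := by
  have : NeZero d := ⟨hd.ne'⟩
  have hF : IsOpenQuotientMap
      (Pi.map fun (i : Fin (n + 1)) (z : ℂ) => if i = 0 then z ^ d else z) := by
    refine .piMap fun i => ?_
    by_cases hi : i = 0
    · simpa only [hi, if_true] using Complex.isOpenQuotientMap_pow d
    · simpa only [hi, if_false] using! IsOpenQuotientMap.id
  have hcomp : (Pi.map fun (i : Fin (n + 1)) (z : ℂ) => if i = 0 then z ^ d else z) ∘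
      Subtype.val = Subtype.val ∘ powFst (n := n) hd := by
    ext v i
    by_cases hi : i = 0
    · subst hi; simp [powFst]
    · simp [powFst, hi]
  have hval : Topology.IsOpenEmbedding
      (Subtype.val : {v : Fin (n + 1) → ℂ // v ≠ 0} → Fin (n + 1) → ℂ) :=
    isOpen_compl_singleton.isOpenEmbedding_subtypeVal
  refine ⟨fun w => ?_, ?_, ?_⟩
  · obtain ⟨v, hv⟩ := hF.surjective w.1
    have hv0 : v ≠ 0 := by
      rintro rfl
      refine w.2 (hv ▸ funext fun i => ?_)
      simp [Pi.map, hd.ne']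
    exact ⟨⟨v, hv0⟩, Subtype.ext ((congrFun hcomp ⟨v, hv0⟩).symm.trans hv)⟩
  · rw [hval.isEmbedding.continuous_iff, ← hcomp]
    exact hF.continuous.comp continuous_subtype_val
  · rw [hval.isOpenMap_iff, ← hcomp]
    exact hF.isOpenMap.comp hval.isOpenMap

/-- If `d` is coprime to `p`, then every `d`-th root of unity is the `p`-th power of one. -/
lemma exists_pow_eq_one_and_pow_eq {M : Type*} [Monoid M] {p d : ℕ} (h : p.Coprime d) {ζ : M}
    (hζ : ζ ^ d = 1) : ∃ ξ : M, ξ ^ d = 1 ∧ ξ ^ p = ζ := by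
  obtain ⟨m, hm⟩ := exists_pow_eq_self_of_coprime
    (h.coprime_dvd_right (orderOf_dvd_of_pow_eq_one hζ))
  exact ⟨ζ ^ m, by rw [pow_right_comm, hζ, one_pow], by rw [pow_right_comm, hm]⟩

lemma wpRel_powFst_iff {n d : ℕ} (hd : 0 < d) {ω η : Fin (n + 1) → ℕ}
    (hcop : (ω 0).Coprime d) (hη0 : η 0 = ω 0)
    (hηi : ∀ i : Fin (n + 1), i ≠ 0 → d * η i = ω i)
    {v w : {v : Fin (n + 1) → ℂ // v ≠ 0}} :
    wpRel η (powFst hd v) (powFst hd w) ↔ wpRel ω v w := by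
  constructor
  · rintro ⟨s, hs, h⟩
    obtain ⟨t, rfl⟩ := IsAlgClosed.exists_pow_nat_eq s hd
    have ht : t ≠ 0 := ne_zero_pow hd.ne' hs
    have h0 : w.1 0 ^ d = (t ^ ω 0 * v.1 0) ^ d := by
      simpa only [powFst_apply_zero, hη0, mul_pow, pow_right_comm t d] using h 0
    obtain ⟨ζ, hζ, hζ0⟩ : ∃ ζ : ℂ, ζ ^ d = 1 ∧ w.1 0 = ζ * (t ^ ω 0 * v.1 0) := by
      by_cases hv : t ^ ω 0 * v.1 0 = 0
      · rw [hv, zero_pow hd.ne', pow_eq_zero_iff hd.ne'] at h0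
        exact ⟨1, one_pow d, by rw [h0, hv, mul_zero]⟩
      · exact ⟨w.1 0 / (t ^ ω 0 * v.1 0), by rw [div_pow, h0, div_self (pow_ne_zero d hv)],
          (div_mul_cancel₀ _ hv).symm⟩
    obtain ⟨ξ, hξ, rfl⟩ := exists_pow_eq_one_and_pow_eq hcop hζ
    have hξ0 : ξ ≠ 0 := ne_zero_pow hd.ne' (hξ ▸ one_ne_zero)
    refine ⟨ξ * t, mul_ne_zero hξ0 ht, fun i => ?_⟩
    by_cases hi : i = 0
    · rw [hi, hζ0, mul_pow, mul_assoc]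
    · have := h i
      rw [powFst_apply_of_ne hd _ hi, powFst_apply_of_ne hd _ hi] at this
      rw [this, ← hηi i hi, pow_mul, mul_pow, hξ, one_mul]
  · rintro ⟨t, ht, h⟩
    refine ⟨t ^ d, pow_ne_zero d ht, fun i => ?_⟩
    by_cases hi : i = 0
    · rw [hi, powFst_apply_zero, powFst_apply_zero, h, mul_pow, hη0, pow_right_comm]
    · rw [powFst_apply_of_ne hd _ hi, powFst_apply_of_ne hd _ hi, h, ← hηi i hi, pow_mul]

/-- Let `ω = (p₀, …, p_n)` be positive weights with `gcd ω = 1`, let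
`d = gcd(p₁, …, p_n)` and `η = (p₀, p₁/d, …, p_n/d)`. Then
`[x₀ : x₁ : ⋯ : x_n]_ω ↦ [x₀^d : x₁ : ⋯ : x_n]_η` is a well-defined homeomorphism
`ℙⁿ_ω → ℙⁿ_η`. -/
theorem wProjSpace_homeomorph (n : ℕ) (hn : 1 ≤ n)
    (ω η : Fin (n + 1) → ℕ) (d : ℕ)
    (hpos : ∀ i, 0 < ω i)
    (hgcd : Finset.univ.gcd ω = 1)
    (hd : d = (Finset.univ.erase (0 : Fin (n + 1))).gcd ω)
    (hη0 : η 0 = ω 0)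
    (hηi : ∀ i : Fin (n + 1), i ≠ 0 → d * η i = ω i) :
    ∃ h : WProjSpace ω ≃ₜ WProjSpace η,
      ∀ (v : Fin (n + 1) → ℂ) (hv : v ≠ 0),
        h (Quot.mk (wpRel ω) ⟨v, hv⟩) =
          Quot.mk (wpRel η)
            ⟨fun i => if i = 0 then v 0 ^ d else v i,
              pow_fst_ne_zero (show 0 < d by rw [hd]; exact gcd_tail_pos n hn ω hpos) hv⟩ := by
  have hd0 : 0 < d := hd ▸ gcd_tail_pos n hn ω hpos
  have hcop : (ω 0).Coprime d := by
    rw [← Finset.insert_erase (Finset.mem_univ (0 : Fin (n + 1))), Finset.gcd_insert, ← hd] at hgcd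
    exact hgcd
  have hiff (v w) : wpRel η (powFst hd0 v) (powFst hd0 w) ↔ wpRel ω v w :=
    wpRel_powFst_iff hd0 hcop hη0 hηi
  let f : WProjSpace ω → WProjSpace η :=
    Quot.map (powFst hd0) fun v w h => (hiff v w).2 h
  have hquot : Topology.IsQuotientMap f :=
    Topology.IsQuotientMap.of_comp_isQuotientMap (f := Quot.mk (wpRel ω)) isQuotientMap_quot_mk
      (isQuotientMap_quot_mk.comp (isOpenQuotientMap_powFst hd0).isQuotientMap)
  have hinj : Function.Injective f := by
    rintro ⟨v⟩ ⟨w⟩ h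
    exact Quot.sound ((hiff v w).1 (((wpRel_equivalence η).quot_mk_eq_iff _ _).1 h))
  exact ⟨(isHomeomorph_iff_isQuotientMap_injective.2 ⟨hquot, hinj⟩).homeomorph f,
    fun v hv => rfl⟩
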